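/- Let 0<q<1. For all m, z, k ∈ ℤ the kernel of order v = 0 satisfies D_0(q^m,q^z,q^k) = (1/(1-q)) q^{-2k} [J_{z-k}(q^{m-k},q²)]². -/

import Mathlib

open scoped BigOperators

noncomputable section

/-- Finite q-Pochhammer symbol `(a;q)_n = ∏_{i=0}^{n-1} (1 - a q^i)`. -/
def qPoch (a q : ℝ) (n : ℕ) : ℝ := ∏ i ∈ Finset.range n, (1 - a * q ^ i)

/-- Infinite q-Pochhammer symbol `(a;q)_∞ = ∏_{i=0}^{∞} (1 - a q^i)`. -/
def qPochInf (a q : ℝ) : ℝ := ∏' i : ℕ, (1 - a * q ^ i)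

/-- Normalized Hahn–Exton q-Bessel function `j_v(x,q²)`. -/
def jHE (q v x : ℝ) : ℝ :=
  ∑' n : ℕ, (-1 : ℝ) ^ n * q ^ (n * (n + 1)) * x ^ (2 * n) /
    (qPoch (q ^ 2) (q ^ 2) n * qPoch (q ^ (2 * v + 2)) (q ^ 2) n)

/-- Hahn–Exton q-Bessel function with base `p`:
`J_v(x,p) = (x^v/(p;p)_∞) Σ_{n} (-1)^n p^{n(n+1)/2} (p^{v+n+1};p)_∞ x^{2n}/(p;p)_n`.
With `p = q²` this is `J_v(x,q²)`. -/
def JHE (p v x : ℝ) : ℝ :=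
  (x ^ v / qPochInf p p) *
    ∑' n : ℕ, (-1 : ℝ) ^ n * p ^ (((n : ℝ) * ((n : ℝ) + 1)) / 2) *
      qPochInf (p ^ (v + (n : ℝ) + 1)) p * x ^ (2 * n) / qPoch p p n

/-- The constant `c_{q,v}`. -/
def cqv (q v : ℝ) : ℝ :=
  (1 / (1 - q)) * qPochInf (q ^ (2 * v + 2)) (q ^ 2) / qPochInf (q ^ 2) (q ^ 2)

/-- Jackson q-integral on `[0,∞)`: `∫_0^∞ f(x) d_q x = (1-q) Σ_{n∈ℤ} q^n f(q^n)`. -/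
def jackson (q : ℝ) (f : ℝ → ℝ) : ℝ := (1 - q) * ∑' n : ℤ, q ^ n * f (q ^ n)

/-- The q-lattice `ℝ_q^+ = {q^n : n ∈ ℤ}`. -/
def Rq (q : ℝ) : Set ℝ := {x | ∃ n : ℤ, x = q ^ n}

/-- Membership in `L_{q,1,v}`: the Jackson integral `∫_0^∞ |f(x)| x^{2v+1} d_q x`
converges (absolutely). -/
def memL1 (q v : ℝ) (f : ℝ → ℝ) : Prop :=
  Summable fun n : ℤ => q ^ n * |f (q ^ n)| * (q ^ n) ^ (2 * v + 1 : ℝ)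

/-- q-Bessel Fourier transform `F_{q,v}`. -/
def qFourier (q v : ℝ) (f : ℝ → ℝ) (x : ℝ) : ℝ :=
  cqv q v * jackson q fun t => f t * jHE q v (x * t) * t ^ (2 * v + 1 : ℝ)

/-- q-translation operator `T_{q,x}^v`. -/
def qTrans (q v x : ℝ) (f : ℝ → ℝ) (y : ℝ) : ℝ :=
  cqv q v * jackson q fun t =>
    qFourier q v f t * jHE q v (x * t) * jHE q v (y * t) * t ^ (2 * v + 1 : ℝ)

/-- The kernel `D_v(x,y,z)`. -/
def Dker (q v x y z : ℝ) : ℝ :=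
  (cqv q v) ^ 2 * jackson q fun t =>
    jHE q v (x * t) * jHE q v (y * t) * jHE q v (z * t) * t ^ (2 * v + 1 : ℝ)

/-- Positivity of the q-translation operator `T_{q,x}^v`. -/
def IsPosT (q v x : ℝ) : Prop :=
  ∀ f : ℝ → ℝ, memL1 q v f → (∀ y ∈ Rq q, 0 ≤ f y) → ∀ y ∈ Rq q, 0 ≤ qTrans q v x f y

/-- The positivity domain `Q_v`. -/
def Qset (v : ℝ) : Set ℝ :=
  {q | q ∈ Set.Ioo (0 : ℝ) 1 ∧ ∀ x ∈ Rq q, IsPosT q v x}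

/-- The kernel `E_{v,x}(q^m,q^z,q^k)`. -/
def Ekern (q v x : ℝ) (m z k : ℤ) : ℝ :=
  (1 / ((1 - q) ^ 2 * cqv q v * cqv q (x - v))) *
    q ^ (-(k : ℝ) * (x + 2) - (m : ℝ) * v - (z : ℝ) * (x - v)) *
    JHE (q ^ 2) ((z : ℝ) - (k : ℝ)) (q ^ (x - v + (m : ℝ) - (k : ℝ))) *
    JHE (q ^ 2) (v + (z : ℝ) - (k : ℝ)) (q ^ ((m : ℝ) - (k : ℝ)))

/-- The function `q ↦ ₁φ₁(0;q;q,q) = Σ_{n} (-1)^n q^{n(n+1)/2} q^n /((q;q)_n)²`. -/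
def phiQ (q : ℝ) : ℝ :=
  ∑' n : ℕ, (-1 : ℝ) ^ n * q ^ (((n : ℝ) * ((n : ℝ) + 1)) / 2) * q ^ n / (qPoch q q n) ^ 2

/-- The sequence `1 / (q²;q²)_n`, extended by zero to negative `n`. -/
def invPoch (q : ℝ) (n : ℤ) : ℝ :=
  if 0 ≤ n then (qPoch (q ^ 2) (q ^ 2) n.toNat)⁻¹ else 0

/-- The coefficients of Euler's expansion of `(q² x;q²)_∞`, extended by zero to negative indices. -/
def eulerCoeff (q : ℝ) (n : ℤ) : ℝ := (-1) ^ n * q ^ (n * (n + 1)) * invPoch q n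

/-- The values `J_0(q^n, q²)` of the Hahn–Exton function of order zero on the `q`-lattice. -/
def latticeBessel (q : ℝ) (n : ℤ) : ℝ := ∑' j : ℤ, invPoch q j * eulerCoeff q j * q ^ (2 * j * n)

lemma invPoch_of_neg (q : ℝ) {n : ℤ} (hn : n < 0) : invPoch q n = 0 := by
  simp [invPoch, not_le.2 hn]

lemma invPoch_natCast (q : ℝ) (n : ℕ) : invPoch q n = (qPoch (q ^ 2) (q ^ 2) n)⁻¹ := by
  simp [invPoch]

lemma invPoch_zero (q : ℝ) : invPoch q 0 = 1 := by
  simp [invPoch, qPoch]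

lemma eulerCoeff_of_neg (q : ℝ) {n : ℤ} (hn : n < 0) : eulerCoeff q n = 0 := by
  simp [eulerCoeff, invPoch_of_neg q hn]

lemma eulerCoeff_zero (q : ℝ) : eulerCoeff q 0 = 1 := by
  simp [eulerCoeff, invPoch_zero]


lemma one_sub_zpow_ne_zero {q : ℝ} (hq0 : 0 < q) (hq1 : q < 1) {n : ℤ} (hn : n ≠ 0) :
    1 - q ^ (2 * n) ≠ 0 := by
  intro h
  have h1 : q ^ (2 * n) = 1 := by linarith
  rw [zpow_eq_one_iff_right₀ hq0.le hq1.ne] at h1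
  omega

lemma invPoch_rec {q : ℝ} (hq0 : 0 < q) (hq1 : q < 1) (n : ℤ) :
    invPoch q n * (1 - q ^ (2 * n)) = invPoch q (n - 1) := by
  rcases lt_trichotomy n 0 with h | h | h
  · rw [invPoch_of_neg q h, invPoch_of_neg q (by omega), zero_mul]
  · subst h
    rw [invPoch_of_neg q (show (0 : ℤ) - 1 < 0 by norm_num)]
    simp
  · obtain ⟨m, rfl⟩ : ∃ m : ℕ, n = m + 1 := ⟨(n - 1).toNat, by omega⟩
    have h1 : ((m : ℤ) + 1 : ℤ) = ((m + 1 : ℕ) : ℤ) := by push_cast; ring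
    have h2 := one_sub_zpow_ne_zero hq0 hq1 (n := ((m + 1 : ℕ) : ℤ)) (by omega)
    rw [add_sub_cancel_right, h1, invPoch_natCast, invPoch_natCast, qPoch, Finset.prod_range_succ,
      ← qPoch]
    have h3 : q ^ (2 * ((m + 1 : ℕ) : ℤ)) = q ^ 2 * (q ^ 2) ^ m := by
      rw [zpow_mul, zpow_natCast, pow_succ']
      norm_cast
    rw [h3] at h2 ⊢
    rw [mul_inv, mul_assoc, inv_mul_cancel₀ h2, mul_one]

lemma eulerCoeff_rec {q : ℝ} (hq0 : 0 < q) (hq1 : q < 1) (n : ℤ) :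
    eulerCoeff q n * (1 - q ^ (2 * n)) = -(q ^ (2 * n) * eulerCoeff q (n - 1)) := by
  have h1 : q ^ (n * (n + 1)) = q ^ (2 * n) * q ^ ((n - 1) * (n - 1 + 1)) := by
    rw [← zpow_add₀ hq0.ne']
    ring_nf
  have h2 : (-1 : ℝ) ^ n = -(-1) ^ (n - 1) := by
    rw [zpow_sub_one₀ (by norm_num)]
    norm_num
  rw [eulerCoeff, eulerCoeff, mul_assoc, invPoch_rec hq0 hq1, h1, h2]
  ring

lemma summable_pow_natAbs {q : ℝ} (hq0 : 0 < q) (hq1 : q < 1) :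
    Summable fun n : ℤ => q ^ n.natAbs := by
  have h := summable_geometric_of_lt_one hq0.le hq1
  exact Summable.of_nat_of_neg (by simpa using h) (by simpa using h)

lemma summable_zpow_sq {q : ℝ} (hq0 : 0 < q) (hq1 : q < 1) (l : ℤ) :
    Summable fun n : ℤ => q ^ (n ^ 2 + l * n) := by
  refine Summable.of_nonneg_of_le (fun n => by positivity) (fun n => ?_)
    ((summable_pow_natAbs hq0 hq1).mul_left (q ^ (-(|l| + 1) ^ 2)))
  rw [← zpow_natCast, ← zpow_add₀ hq0.ne']
  apply zpow_le_zpow_right_of_le_one₀ hq0 hq1.le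
  rw [Int.natCast_natAbs]
  have h1 : -(|l| * |n|) ≤ l * n := by rw [← abs_mul]; exact neg_abs_le _
  have h2 := sq_abs n
  nlinarith [abs_nonneg l, abs_nonneg n, sq_nonneg (|n| - (|l| + 1)),
    mul_nonneg (abs_nonneg l) (abs_nonneg n)]

lemma summable_sq_pow {q : ℝ} (hq0 : 0 < q) (hq1 : q < 1) (c : ℝ) :
    Summable fun i : ℕ => ‖-(c * (q ^ 2) ^ i)‖ := by
  simp only [norm_neg, norm_mul]
  refine Summable.mul_left _ ?_
  simpa using summable_geometric_of_lt_one (sq_nonneg q) (by nlinarith)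

lemma multipliable_qPochInf {q : ℝ} (hq0 : 0 < q) (hq1 : q < 1) (c : ℝ) :
    Multipliable fun i : ℕ => 1 - c * (q ^ 2) ^ i := by
  simpa [sub_eq_add_neg] using multipliable_one_add_of_summable (summable_sq_pow hq0 hq1 c)

lemma qPochInf_sq_ne_zero {q : ℝ} (hq0 : 0 < q) (hq1 : q < 1) : qPochInf (q ^ 2) (q ^ 2) ≠ 0 := by
  have h := tprod_one_add_ne_zero_of_summable (f := fun i : ℕ => -(q ^ 2 * (q ^ 2) ^ i))
    (fun i => ?_) (summable_sq_pow hq0 hq1 _)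
  · simpa [qPochInf, sub_eq_add_neg] using h
  · have h1 : q ^ 2 * (q ^ 2) ^ i < 1 := by
      rw [← pow_succ']
      exact pow_lt_one₀ (sq_nonneg q) (by nlinarith) (by omega)
    have : 1 + -(q ^ 2 * (q ^ 2) ^ i) > 0 := by linarith
    exact this.ne'

lemma exists_abs_invPoch_le {q : ℝ} (hq0 : 0 < q) (hq1 : q < 1) :
    ∃ A : ℝ, 0 < A ∧ ∀ n, |invPoch q n| ≤ A := by
  have h1 : Filter.Tendsto (fun n : ℕ => |(qPoch (q ^ 2) (q ^ 2) n)⁻¹|) Filter.atTop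
      (nhds |(qPochInf (q ^ 2) (q ^ 2))⁻¹|) :=
    ((multipliable_qPochInf hq0 hq1 (q ^ 2)).hasProd.tendsto_prod_nat.inv₀
      (qPochInf_sq_ne_zero hq0 hq1)).abs
  obtain ⟨A, hA⟩ := h1.bddAbove_range
  refine ⟨max A 1, by positivity, fun n => ?_⟩
  rcases lt_or_ge n 0 with h | h
  · rw [invPoch_of_neg q h, abs_zero]
    positivity
  · lift n to ℕ using h
    rw [invPoch_natCast]
    exact (hA ⟨n, rfl⟩).trans (le_max_left _ _)

lemma abs_eulerCoeff {q : ℝ} (hq0 : 0 < q) (n : ℤ) :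
    |eulerCoeff q n| = q ^ (n * (n + 1)) * |invPoch q n| := by
  rw [eulerCoeff, abs_mul, abs_mul, abs_zpow, abs_neg, abs_one, one_zpow, one_mul,
    abs_of_pos (zpow_pos hq0 _)]

lemma summable_abs_eulerCoeff {q : ℝ} (hq0 : 0 < q) (hq1 : q < 1) (l : ℤ) :
    Summable fun n : ℤ => |eulerCoeff q n| * q ^ (l * n) := by
  obtain ⟨A, hA, hb⟩ := exists_abs_invPoch_le hq0 hq1
  refine Summable.of_nonneg_of_le (fun n => by positivity) (fun n => ?_)
    ((summable_zpow_sq hq0 hq1 (l + 1)).mul_left A)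
  have h : q ^ (n ^ 2 + (l + 1) * n) = q ^ (n * (n + 1)) * q ^ (l * n) := by
    rw [← zpow_add₀ hq0.ne']; ring_nf
  rw [abs_eulerCoeff hq0, h]
  have := mul_le_mul_of_nonneg_left (hb n)
    (show 0 ≤ q ^ (n * (n + 1)) * q ^ (l * n) by positivity)
  linarith

lemma summable_mul_eulerCoeff {q : ℝ} (hq0 : 0 < q) (hq1 : q < 1) (l : ℤ) {f : ℤ → ℝ} {C : ℝ}
    (hf : ∀ n, |f n| ≤ C) : Summable fun n : ℤ => ‖f n * (eulerCoeff q n * q ^ (l * n))‖ := by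
  refine Summable.of_nonneg_of_le (fun n => by positivity) (fun n => ?_)
    ((summable_abs_eulerCoeff hq0 hq1 l).mul_left C)
  rw [Real.norm_eq_abs, abs_mul, abs_mul, abs_of_pos (zpow_pos hq0 (l * n))]
  exact mul_le_mul_of_nonneg_right (hf n) (by positivity)

lemma summable_eulerCoeff_zpow {q : ℝ} (hq0 : 0 < q) (hq1 : q < 1) (l : ℤ) :
    Summable fun n : ℤ => eulerCoeff q n * q ^ (l * n) := by
  have h := summable_mul_eulerCoeff hq0 hq1 l (f := fun _ => 1) (C := 1) (by simp)
  simpa using h.of_norm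

lemma tsum_shift (g : ℤ → ℝ) (l : ℤ) : ∑' i, g (i - l) = ∑' i, g i :=
  (Equiv.subRight l).tsum_eq g

lemma tsum_eulerCoeff_sub_one {q : ℝ} (hq0 : 0 < q) (hq1 : q < 1) (m : ℤ) :
    (∑' i : ℤ, eulerCoeff q i * q ^ (2 * m * i)) * (1 - q ^ (2 * m)) =
      ∑' i : ℤ, eulerCoeff q i * q ^ (2 * (m - 1) * i) := by
  have hs := summable_eulerCoeff_zpow hq0 hq1 (2 * m)
  have hs' := summable_eulerCoeff_zpow hq0 hq1 (2 * (m - 1))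
  have h1 : (∑' i : ℤ, eulerCoeff q i * q ^ (2 * (m - 1) * i)) -
      ∑' i : ℤ, eulerCoeff q i * q ^ (2 * m * i) =
      ∑' i : ℤ, -q ^ (2 * m) * (eulerCoeff q (i - 1) * q ^ (2 * m * (i - 1))) := by
    rw [← hs'.tsum_sub hs]
    refine tsum_congr fun i => ?_
    have e1 : q ^ (2 * m * i) = q ^ (2 * (m - 1) * i) * q ^ (2 * i) := by
      rw [← zpow_add₀ hq0.ne']; ring_nf
    have e2 : q ^ (2 * (m - 1) * i) * q ^ (2 * i) = q ^ (2 * m) * q ^ (2 * m * (i - 1)) := by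
      rw [← zpow_add₀ hq0.ne', ← zpow_add₀ hq0.ne']; ring_nf
    rw [e1]
    linear_combination q ^ (2 * (m - 1) * i) * eulerCoeff_rec hq0 hq1 i -
      eulerCoeff q (i - 1) * e2
  rw [tsum_mul_left, tsum_shift (fun i => eulerCoeff q i * q ^ (2 * m * i))] at h1
  linear_combination -h1

lemma tsum_eulerCoeff_natCast {q : ℝ} (hq0 : 0 < q) (hq1 : q < 1) (m : ℕ) :
    (∑' i : ℤ, eulerCoeff q i * q ^ (2 * (m : ℤ) * i)) =
      (∑' i : ℤ, eulerCoeff q i * q ^ (2 * 0 * i)) * invPoch q m := by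
  induction m with
  | zero => simp [invPoch_zero]
  | succ m ih =>
    have h1 := tsum_eulerCoeff_sub_one hq0 hq1 ((m : ℤ) + 1)
    have h2 := invPoch_rec hq0 hq1 ((m : ℤ) + 1)
    have h3 := one_sub_zpow_ne_zero hq0 hq1 (n := (m : ℤ) + 1) (by omega)
    rw [add_sub_cancel_right] at h1 h2
    rw [ih, ← h2, ← mul_assoc] at h1
    push_cast
    exact mul_right_cancel₀ h3 h1

lemma tsum_eulerCoeff_of_neg {q : ℝ} (hq0 : 0 < q) (hq1 : q < 1) (m : ℕ) :
    (∑' i : ℤ, eulerCoeff q i * q ^ (2 * (-(m : ℤ) - 1) * i)) = 0 := by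
  induction m with
  | zero => simpa using (tsum_eulerCoeff_sub_one hq0 hq1 0).symm
  | succ m ih =>
    rw [← tsum_eulerCoeff_sub_one hq0 hq1, show -((m + 1 : ℕ) : ℤ) = -(m : ℤ) - 1 by push_cast; ring,
      ih, zero_mul]

lemma tsum_eulerCoeff {q : ℝ} (hq0 : 0 < q) (hq1 : q < 1) (m : ℤ) :
    (∑' i : ℤ, eulerCoeff q i * q ^ (2 * m * i)) =
      (∑' i : ℤ, eulerCoeff q i * q ^ (2 * 0 * i)) * invPoch q m := by
  rcases lt_or_ge m 0 with h | h
  · obtain ⟨n, rfl⟩ : ∃ n : ℕ, m = -(n : ℤ) - 1 := ⟨(-m - 1).toNat, by omega⟩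
    rw [tsum_eulerCoeff_of_neg hq0 hq1, invPoch_of_neg q h, mul_zero]
  · lift m to ℕ using h
    exact tsum_eulerCoeff_natCast hq0 hq1 m

lemma tsum_eulerCoeff_ne_zero {q : ℝ} (hq0 : 0 < q) (hq1 : q < 1) :
    (∑' i : ℤ, eulerCoeff q i * q ^ (2 * 0 * i)) ≠ 0 := by
  intro h0
  have hz : ∀ m : ℕ, (∑' i : ℤ, eulerCoeff q i * q ^ (2 * (m : ℤ) * i)) = 0 := fun m => by
    rw [tsum_eulerCoeff hq0 hq1, h0, zero_mul]
  have hlim : Filter.Tendsto (fun m : ℕ => ∑' i : ℤ, eulerCoeff q i * q ^ (2 * (m : ℤ) * i))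
      Filter.atTop (nhds (∑' i : ℤ, if i = 0 then (1 : ℝ) else 0)) := by
    refine tendsto_tsum_of_dominated_convergence
      (by simpa using summable_abs_eulerCoeff hq0 hq1 0) (fun i => ?_)
      (Filter.Eventually.of_forall fun m i => ?_)
    · rcases lt_trichotomy i 0 with h | h | h
      · simp [eulerCoeff_of_neg q h, h.ne]
      · simp [h, eulerCoeff_zero]
      · lift i to ℕ using h.le
        have hi : i ≠ 0 := by omega
        have e : ∀ m : ℕ, q ^ (2 * (m : ℤ) * i) = (q ^ (2 * i)) ^ m := fun m => by
          rw [← pow_mul, ← zpow_natCast]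
          push_cast
          ring_nf
        simp only [e, h.ne', if_false]
        simpa using (tendsto_pow_atTop_nhds_zero_of_lt_one (by positivity)
          (pow_lt_one₀ hq0.le hq1 (by omega : 2 * i ≠ 0))).const_mul (eulerCoeff q i)
    · rcases lt_or_ge i 0 with h | h
      · simp [eulerCoeff_of_neg q h]
      · rw [norm_mul, Real.norm_eq_abs, Real.norm_eq_abs, abs_of_pos (zpow_pos hq0 _)]
        exact mul_le_of_le_one_right (abs_nonneg _)
          (zpow_le_one₀ hq0 hq1.le (by positivity))
  simp only [hz, tsum_ite_eq] at hlim
  exact zero_ne_one (tendsto_nhds_unique tendsto_const_nhds hlim)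

/-- The symmetry `J_0(q^n, q²) = J_n(1, q²)`. -/
lemma latticeBessel_eq {q : ℝ} (hq0 : 0 < q) (hq1 : q < 1) (n : ℤ) :
    latticeBessel q n = ∑' k : ℤ, eulerCoeff q k * invPoch q (n + k) := by
  set c := ∑' i : ℤ, eulerCoeff q i * q ^ (2 * 0 * i) with hc
  have hsum : Summable (Function.uncurry fun k i : ℤ =>
      eulerCoeff q k * (eulerCoeff q i * q ^ (2 * (n + k) * i))) := by
    have h := ((summable_abs_eulerCoeff hq0 hq1 0).mul_of_nonneg
      (summable_abs_eulerCoeff hq0 hq1 (2 * n)) (fun _ => by positivity) (fun _ => by positivity))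
    refine Summable.of_norm_bounded h ?_
    rintro ⟨k, i⟩
    simp only [Function.uncurry, zero_mul, zpow_zero, mul_one]
    rcases lt_or_ge k 0 with hk | hk
    · simp [eulerCoeff_of_neg q hk]
    rcases lt_or_ge i 0 with hi | hi
    · simp [eulerCoeff_of_neg q hi]
    rw [norm_mul, norm_mul, Real.norm_eq_abs, Real.norm_eq_abs, Real.norm_eq_abs,
      abs_of_pos (zpow_pos hq0 _)]
    gcongr ?_ * (?_ * ?_)
    apply zpow_le_zpow_right_of_le_one₀ hq0 hq1.le
    nlinarith [mul_nonneg hk hi]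
  apply mul_left_cancel₀ (tsum_eulerCoeff_ne_zero hq0 hq1)
  rw [← hc, ← tsum_mul_left, latticeBessel, ← tsum_mul_left]
  calc ∑' i, c * (invPoch q i * eulerCoeff q i * q ^ (2 * i * n))
      = ∑' i, ∑' k, eulerCoeff q k * (eulerCoeff q i * q ^ (2 * (n + k) * i)) := by
        refine tsum_congr fun i => ?_
        have h := tsum_eulerCoeff hq0 hq1 i
        rw [← hc] at h
        calc _ = eulerCoeff q i * q ^ (2 * n * i) * (c * invPoch q i) := by ring_nf
          _ = _ := by
            rw [← h, ← tsum_mul_left]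
            refine tsum_congr fun k => ?_
            have e : q ^ (2 * (n + k) * i) = q ^ (2 * n * i) * q ^ (2 * i * k) := by
              rw [← zpow_add₀ hq0.ne']; ring_nf
            rw [e]; ring
    _ = ∑' k, ∑' i, eulerCoeff q k * (eulerCoeff q i * q ^ (2 * (n + k) * i)) := hsum.tsum_comm
    _ = _ := by
        refine tsum_congr fun k => ?_
        rw [tsum_mul_left, tsum_eulerCoeff hq0 hq1, ← hc]
        ring

lemma summable_latticeBessel {q : ℝ} (hq0 : 0 < q) (hq1 : q < 1) (n : ℤ) :
    Summable fun j : ℤ => invPoch q j * eulerCoeff q j * q ^ (2 * j * n) := by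
  obtain ⟨A, -, hb⟩ := exists_abs_invPoch_le hq0 hq1
  refine (summable_mul_eulerCoeff hq0 hq1 (2 * n) hb).of_norm.congr fun j => ?_
  ring_nf

lemma summable_eulerCoeff_mul_invPoch {q : ℝ} (hq0 : 0 < q) (hq1 : q < 1) (n l : ℤ) :
    Summable fun k : ℤ => ‖eulerCoeff q k * invPoch q (n + k) * q ^ (l * k)‖ := by
  obtain ⟨A, -, hb⟩ := exists_abs_invPoch_le hq0 hq1
  refine (summable_mul_eulerCoeff hq0 hq1 l (f := fun k => invPoch q (n + k))
    fun k => hb _).congr fun k => ?_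
  congr 1
  ring

/-- The second order `q`-difference equation satisfied by `J_0(·, q²)`. -/
lemma latticeBessel_rec {q : ℝ} (hq0 : 0 < q) (hq1 : q < 1) (n : ℤ) :
    latticeBessel q (n + 1) - 2 * latticeBessel q n + latticeBessel q (n - 1) =
      -(q ^ (2 * n) * latticeBessel q n) := by
  have hs := summable_latticeBessel hq0 hq1
  rw [latticeBessel, latticeBessel, latticeBessel, ← tsum_mul_left,
    ← (hs _).tsum_sub ((hs _).mul_left 2), ← ((hs _).sub ((hs _).mul_left 2)).tsum_add (hs _),
    ← tsum_mul_left, ← tsum_neg, ← tsum_shift (fun j => -(q ^ (2 * n) * (invPoch q j * eulerCoeff q j * q ^ (2 * j * n)))) 1]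
  refine tsum_congr fun j => ?_
  have e1 : q ^ (2 * j * (n + 1)) = q ^ (2 * j) * q ^ (2 * j) * q ^ (2 * j * (n - 1)) := by
    rw [← zpow_add₀ hq0.ne', ← zpow_add₀ hq0.ne']; ring_nf
  have e2 : q ^ (2 * j * n) = q ^ (2 * j) * q ^ (2 * j * (n - 1)) := by
    rw [← zpow_add₀ hq0.ne']; ring_nf
  have e3 : q ^ (2 * n) * q ^ (2 * (j - 1) * n) = q ^ (2 * j) * q ^ (2 * j * (n - 1)) := by
    rw [← zpow_add₀ hq0.ne', ← zpow_add₀ hq0.ne']; ring_nf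
  have r1 := invPoch_rec hq0 hq1 j
  have r2 := eulerCoeff_rec hq0 hq1 j
  rw [e1, e2, ← r1]
  linear_combination invPoch q j * (1 - q ^ (2 * j)) * q ^ (2 * j * (n - 1)) * r2 +
    invPoch q j * (1 - q ^ (2 * j)) * eulerCoeff q (j - 1) * e3

lemma exists_abs_latticeBessel_le {q : ℝ} (hq0 : 0 < q) (hq1 : q < 1) :
    ∃ C : ℝ, 0 < C ∧ (∀ n, |latticeBessel q n| ≤ C) ∧
      ∀ n ≤ 0, |latticeBessel q n| ≤ C * q ^ (n * (n - 1)) := by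
  obtain ⟨A, hA, hb⟩ := exists_abs_invPoch_le hq0 hq1
  have hθ := summable_zpow_sq hq0 hq1 1
  have hθ0 : 0 < ∑' n : ℤ, q ^ (n ^ 2 + 1 * n) :=
    hθ.tsum_pos (fun n => by positivity) 0 (by positivity)
  refine ⟨A * A * ∑' n : ℤ, q ^ (n ^ 2 + 1 * n), by positivity, fun n => ?_, fun n hn => ?_⟩
  · rw [latticeBessel_eq hq0 hq1, ← Real.norm_eq_abs]
    refine tsum_of_norm_bounded (hθ.hasSum.mul_left (A * A)) fun k => ?_
    rw [norm_mul, Real.norm_eq_abs, Real.norm_eq_abs, abs_eulerCoeff hq0,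
      show k ^ 2 + 1 * k = k * (k + 1) by ring]
    calc q ^ (k * (k + 1)) * |invPoch q k| * |invPoch q (n + k)|
        ≤ q ^ (k * (k + 1)) * A * A := by gcongr <;> exact hb _
      _ = _ := by ring
  · rw [latticeBessel_eq hq0 hq1, ← Real.norm_eq_abs]
    have h := ((Equiv.addRight n).hasSum_iff.2 hθ.hasSum).mul_left (A * A * q ^ (n * (n - 1)))
    refine (tsum_of_norm_bounded h fun k => ?_).trans_eq (by ring)
    simp only [Function.comp, Equiv.coe_addRight]
    rcases lt_or_ge (n + k) 0 with hk | hk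
    · rw [invPoch_of_neg q hk, mul_zero, norm_zero]
      positivity
    rw [norm_mul, Real.norm_eq_abs, Real.norm_eq_abs, abs_eulerCoeff hq0]
    calc q ^ (k * (k + 1)) * |invPoch q k| * |invPoch q (n + k)|
        ≤ q ^ (n * (n - 1) + ((k + n) ^ 2 + 1 * (k + n))) * A * A := by
          gcongr ?_ * ?_ * ?_
          · apply zpow_le_zpow_right_of_le_one₀ hq0 hq1.le
            nlinarith
          · exact hb _
          · exact hb _
      _ = _ := by rw [zpow_add₀ hq0.ne']; ring

lemma exists_abs_latticeBessel_le_of_le {q : ℝ} (hq0 : 0 < q) (hq1 : q < 1) {K : ℤ} (hK : 0 ≤ K) :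
    ∃ C : ℝ, 0 < C ∧ ∀ n ≤ K, |latticeBessel q n| ≤ C * q ^ (n * (n - 1)) := by
  obtain ⟨C, hC, h1, h2⟩ := exists_abs_latticeBessel_le hq0 hq1
  refine ⟨C * q ^ (-K ^ 2), by positivity, fun n hn => ?_⟩
  rw [mul_assoc, ← zpow_add₀ hq0.ne']
  rcases le_or_gt n 0 with h | h
  · refine (h2 n h).trans ?_
    refine mul_le_mul_of_nonneg_left (zpow_le_zpow_right_of_le_one₀ hq0 hq1.le ?_) hC.le
    nlinarith [sq_nonneg K]
  · refine (h1 n).trans (le_mul_of_one_le_right hC.le ?_)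
    apply one_le_zpow_of_nonpos₀ hq0 hq1.le
    nlinarith

lemma zpow_two_mul_le_pow_natAbs {q : ℝ} (hq0 : 0 < q) (hq1 : q < 1) {n : ℤ} (hn : 0 ≤ n) :
    q ^ (2 * n) ≤ q ^ n.natAbs := by
  rw [← zpow_natCast, Int.natCast_natAbs, abs_of_nonneg hn]
  apply zpow_le_zpow_right_of_le_one₀ hq0 hq1.le
  omega

lemma summable_triple_kernel {q : ℝ} (hq0 : 0 < q) (hq1 : q < 1) (a b : ℤ) :
    Summable (Function.uncurry fun n j : ℤ => q ^ (2 * n) *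
      (latticeBessel q n * latticeBessel q (n + a)) *
        (invPoch q j * eulerCoeff q j * q ^ (2 * j * (b + n)))) := by
  obtain ⟨A, hA, hb⟩ := exists_abs_invPoch_le hq0 hq1
  obtain ⟨C, hC, h1, h2⟩ := exists_abs_latticeBessel_le hq0 hq1
  obtain ⟨D, hD, h3⟩ := exists_abs_latticeBessel_le_of_le hq0 hq1 (abs_nonneg a)
  have s1 := ((summable_pow_natAbs hq0 hq1).mul_of_nonneg
    (summable_abs_eulerCoeff hq0 hq1 (2 * b)) (fun _ => by positivity)
    (fun _ => by positivity)).mul_left (C * C * A)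
  have s2 := (((summable_zpow_sq hq0 hq1 (2 * a - 1 - 2 * b)).mul_of_nonneg
    (summable_zpow_sq hq0 hq1 (1 + 2 * b)) (fun _ => by positivity)
    (fun _ => by positivity)).mul_left (C * D * A * A * q ^ (a * (a - 1)))).comp_injective
    (Equiv.prodShear (Equiv.refl ℤ) fun n => Equiv.addRight n).injective
  refine Summable.of_norm_bounded (s1.add s2) ?_
  rintro ⟨n, j⟩
  simp only [Function.uncurry, Function.comp, Equiv.prodShear_apply, Equiv.refl_apply,
    Equiv.coe_addRight, norm_mul, Real.norm_eq_abs, abs_of_pos (zpow_pos hq0 _)]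
  rcases lt_or_ge j 0 with hj | hj
  · simp only [invPoch_of_neg q hj, abs_zero, zero_mul, mul_zero]
    positivity
  rcases le_or_gt 0 n with hn | hn
  · refine le_add_of_le_of_nonneg ?_ (by positivity)
    calc q ^ (2 * n) * (|latticeBessel q n| * |latticeBessel q (n + a)|) *
          (|invPoch q j| * |eulerCoeff q j| * q ^ (2 * j * (b + n)))
        ≤ q ^ n.natAbs * (C * C) * (A * |eulerCoeff q j| * q ^ (2 * b * j)) := by
          gcongr ?_ * (?_ * ?_) * (?_ * _ * ?_)
          · exact zpow_two_mul_le_pow_natAbs hq0 hq1 hn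
          · exact h1 _
          · exact h1 _
          · exact hb _
          · apply zpow_le_zpow_right_of_le_one₀ hq0 hq1.le
            nlinarith [mul_nonneg hj hn]
      _ = _ := by ring
  · refine le_add_of_nonneg_of_le (by positivity) ?_
    rw [abs_eulerCoeff hq0]
    have e : q ^ (2 * n) * q ^ (n * (n - 1)) * q ^ ((n + a) * (n + a - 1)) * q ^ (j * (j + 1)) *
        q ^ (2 * j * (b + n)) = q ^ (a * (a - 1)) * (q ^ (n ^ 2 + (2 * a - 1 - 2 * b) * n) *
          q ^ ((j + n) ^ 2 + (1 + 2 * b) * (j + n))) := by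
      simp only [← zpow_add₀ hq0.ne']
      ring_nf
    calc q ^ (2 * n) * (|latticeBessel q n| * |latticeBessel q (n + a)|) *
          (|invPoch q j| * (q ^ (j * (j + 1)) * |invPoch q j|) * q ^ (2 * j * (b + n)))
        ≤ q ^ (2 * n) * ((C * q ^ (n * (n - 1))) * (D * q ^ ((n + a) * (n + a - 1)))) *
          (A * (q ^ (j * (j + 1)) * A) * q ^ (2 * j * (b + n))) := by
          gcongr
          · exact h2 _ hn.le
          · exact h3 _ (by linarith [le_abs_self a])
          · exact hb _
          · exact hb _
      _ = _ := by linear_combination (C * D * A * A) * e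

lemma summable_moment {q : ℝ} (hq0 : 0 < q) (hq1 : q < 1) (j : ℕ) (a : ℤ) :
    Summable fun n : ℤ => q ^ (2 * n * (j + 1)) * (latticeBessel q n * latticeBessel q (n + a)) := by
  obtain ⟨C, hC, h1, h2⟩ := exists_abs_latticeBessel_le hq0 hq1
  refine Summable.of_norm_bounded (((summable_pow_natAbs hq0 hq1).add
    (summable_zpow_sq hq0 hq1 (2 * j + 1))).mul_left (C * C)) fun n => ?_
  simp only [norm_mul, Real.norm_eq_abs, abs_of_pos (zpow_pos hq0 _)]
  rcases le_or_gt 0 n with hn | hn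
  · calc q ^ (2 * n * (j + 1)) * (|latticeBessel q n| * |latticeBessel q (n + a)|)
        ≤ q ^ n.natAbs * (C * C) := by
          gcongr
          · refine le_trans ?_ (zpow_two_mul_le_pow_natAbs hq0 hq1 hn)
            apply zpow_le_zpow_right_of_le_one₀ hq0 hq1.le
            nlinarith [mul_nonneg hn (Int.natCast_nonneg j)]
          · exact h1 _
          · exact h1 _
      _ ≤ _ := by
          have : 0 < q ^ (n ^ 2 + (2 * (j : ℤ) + 1) * n) := by positivity
          nlinarith [mul_pos (mul_pos hC hC) this]
  · calc q ^ (2 * n * (j + 1)) * (|latticeBessel q n| * |latticeBessel q (n + a)|)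
        ≤ q ^ (2 * n * (j + 1)) * ((C * q ^ (n * (n - 1))) * C) := by
          gcongr
          · exact h2 _ hn.le
          · exact h1 _
      _ = C * C * q ^ (n ^ 2 + (2 * (j : ℤ) + 1) * n) := by
          have e : q ^ (n ^ 2 + (2 * (j : ℤ) + 1) * n) =
              q ^ (2 * n * (j + 1)) * q ^ (n * (n - 1)) := by
            rw [← zpow_add₀ hq0.ne']
            ring_nf
          rw [e]; ring
      _ ≤ _ := by gcongr; exact le_add_of_nonneg_left (by positivity)

/-- The products `b_k / (q²;q²)_{N-k}`, with `b_k` the Euler coefficients: up to the factor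
`(q²;q²)_N`, the coefficients of the polynomial `(q² x;q²)_N`. -/
def eulerConv (q : ℝ) (N k : ℤ) : ℝ := eulerCoeff q k * invPoch q (N - k)

lemma eulerConv_eq_zero (q : ℝ) {N k : ℤ} (h : k ∉ Finset.Icc 0 N) : eulerConv q N k = 0 := by
  rw [Finset.mem_Icc, not_and_or, not_le, not_le] at h
  rcases h with h | h
  · rw [eulerConv, eulerCoeff_of_neg q h, zero_mul]
  · rw [eulerConv, invPoch_of_neg q (by omega), mul_zero]

lemma eulerConv_zero (q : ℝ) (k : ℤ) : eulerConv q 0 k = if k = 0 then 1 else 0 := by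
  split_ifs with h
  · simp [h, eulerConv, eulerCoeff_zero, invPoch_zero]
  · apply eulerConv_eq_zero
    simpa using h

lemma eulerConv_rec {q : ℝ} (hq0 : 0 < q) (hq1 : q < 1) (N k : ℤ) :
    (1 - q ^ (2 * N)) * eulerConv q N k =
      q ^ (2 * k) * (eulerConv q (N - 1) k - eulerConv q (N - 1) (k - 1)) := by
  have r1 := invPoch_rec hq0 hq1 (N - k)
  have r2 := eulerCoeff_rec hq0 hq1 k
  have e : q ^ (2 * N) = q ^ (2 * k) * q ^ (2 * (N - k)) := by
    rw [← zpow_add₀ hq0.ne']; ring_nf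
  simp only [eulerConv]
  rw [show N - 1 - k = N - k - 1 by ring, show N - 1 - (k - 1) = N - k by ring, ← r1, e]
  linear_combination invPoch q (N - k) * r2

lemma summable_eulerConv_mul (q : ℝ) (N : ℤ) (g : ℤ → ℝ) :
    Summable fun k => eulerConv q N k * g k :=
  summable_of_ne_finset_zero (s := Finset.Icc 0 N) fun k hk => by
    rw [eulerConv_eq_zero q hk, zero_mul]

lemma tsum_eulerConv {q : ℝ} (hq0 : 0 < q) (hq1 : q < 1) (N : ℤ) :
    ∑' k : ℤ, eulerConv q N k * q ^ (-(2 * k)) = if N = 0 then 1 else 0 := by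
  split_ifs with hN
  · subst hN
    rw [tsum_eq_single 0 fun k hk => by simp [eulerConv_zero, hk]]
    simp [eulerConv_zero]
  · have hs : Summable fun k => eulerConv q (N - 1) k := by
      simpa using summable_eulerConv_mul q (N - 1) 1
    have hs' : Summable fun k => eulerConv q (N - 1) (k - 1) :=
      hs.comp_injective (Equiv.subRight (1 : ℤ)).injective
    refine (mul_eq_zero.1 ?_).resolve_left (one_sub_zpow_ne_zero hq0 hq1 hN)
    rw [← tsum_mul_left]
    calc _ = ∑' k, (eulerConv q (N - 1) k - eulerConv q (N - 1) (k - 1)) := by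
          refine tsum_congr fun k => ?_
          rw [← mul_assoc, eulerConv_rec hq0 hq1, zpow_neg]
          field_simp
      _ = 0 := by rw [hs.tsum_sub hs', tsum_shift (eulerConv q (N - 1)), sub_self]

lemma summable_orthogonality {q : ℝ} (hq0 : 0 < q) (hq1 : q < 1) (l : ℤ) :
    Summable (Function.uncurry fun (x : ℤ × ℤ) (n : ℤ) => q ^ (2 * n) *
      ((eulerCoeff q x.2 * invPoch q (n + x.2)) * (eulerCoeff q x.1 * invPoch q (n + l + x.1)))) := by
  obtain ⟨A, hA, hb⟩ := exists_abs_invPoch_le hq0 hq1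
  have s0 := (summable_abs_eulerCoeff hq0 hq1 0).mul_of_nonneg
    (summable_abs_eulerCoeff hq0 hq1 (-2)) (fun _ => by positivity) (fun _ => by positivity)
  have s1 := ((s0.mul_of_nonneg (summable_pow_natAbs hq0 hq1) (fun _ => by positivity)
    (fun _ => by positivity)).mul_left (A * A)).comp_injective
    (Equiv.prodShear (Equiv.refl (ℤ × ℤ)) fun x => Equiv.addRight x.2).injective
  refine Summable.of_norm_bounded s1 ?_
  rintro ⟨⟨i, j⟩, n⟩
  simp only [Function.uncurry, Function.comp, Equiv.prodShear_apply, Equiv.refl_apply,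
    Equiv.coe_addRight, norm_mul, Real.norm_eq_abs, abs_of_pos (zpow_pos hq0 _)]
  rcases lt_or_ge (n + j) 0 with hn | hn
  · simp only [invPoch_of_neg q hn, abs_zero, zero_mul, mul_zero]
    positivity
  have e : q ^ (2 * n) = q ^ (2 * (n + j)) * q ^ (-2 * j) := by
    rw [← zpow_add₀ hq0.ne']; ring_nf
  rw [e, zero_mul, zpow_zero, mul_one]
  calc q ^ (2 * (n + j)) * q ^ (-2 * j) * (|eulerCoeff q j| * |invPoch q (n + j)| *
        (|eulerCoeff q i| * |invPoch q (n + l + i)|))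
      ≤ q ^ (n + j).natAbs * q ^ (-2 * j) * (|eulerCoeff q j| * A *
        (|eulerCoeff q i| * A)) := by
        gcongr
        · exact zpow_two_mul_le_pow_natAbs hq0 hq1 hn
        · exact hb _
        · exact hb _
    _ = _ := by ring

/-- Orthogonality of the functions `n ↦ J_0(q^{n+l}, q²)`. -/
lemma tsum_latticeBessel_mul {q : ℝ} (hq0 : 0 < q) (hq1 : q < 1) (l : ℤ) :
    ∑' n : ℤ, q ^ (2 * n) * (latticeBessel q n * latticeBessel q (n + l)) =
      if l = 0 then 1 else 0 := by
  obtain ⟨F, hFdef⟩ : ∃ F : ℤ × ℤ → ℤ → ℝ, F = fun x n => q ^ (2 * n) *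
    ((eulerCoeff q x.2 * invPoch q (n + x.2)) * (eulerCoeff q x.1 * invPoch q (n + l + x.1))) :=
    ⟨_, rfl⟩
  have hF : Summable (Function.uncurry F) := by
    rw [hFdef]
    exact summable_orthogonality hq0 hq1 l
  have hG : Summable (Function.uncurry fun (x : ℤ × ℤ) (M : ℤ) => F x (M - (x.1 + x.2))) := by
    have h := hF.comp_injective
      (Equiv.prodShear (Equiv.refl (ℤ × ℤ)) fun x => Equiv.subRight (x.1 + x.2)).injective
    exact h
  have hconv : ∀ N, Summable fun k => ‖eulerConv q N k * q ^ (-(2 * k))‖ := fun N =>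
    (summable_eulerConv_mul q N _).norm
  have hprod : ∀ n : ℤ, Summable fun k => ‖eulerCoeff q k * invPoch q (n + k)‖ := fun n => by
    simpa using summable_eulerCoeff_mul_invPoch hq0 hq1 n 0
  calc _ = ∑' n, ∑' x, F x n := by
        refine tsum_congr fun n => ?_
        rw [mul_comm (latticeBessel q n), latticeBessel_eq hq0 hq1,
          latticeBessel_eq hq0 hq1, tsum_mul_tsum_of_summable_norm (hprod _) (hprod _),
          ← tsum_mul_left]
        refine tsum_congr fun x => ?_
        rw [hFdef]
        ring
    _ = ∑' x, ∑' n, F x n := hF.tsum_comm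
    _ = ∑' x, ∑' M, F x (M - (x.1 + x.2)) := tsum_congr fun x => (tsum_shift (F x) _).symm
    _ = ∑' M, ∑' x, F x (M - (x.1 + x.2)) := hG.tsum_comm.symm
    _ = ∑' M : ℤ, q ^ (2 * M) * ((if M = 0 then 1 else 0) * (if M + l = 0 then 1 else 0)) := by
        refine tsum_congr fun M => ?_
        rw [← tsum_eulerConv hq0 hq1 M, ← tsum_eulerConv hq0 hq1 (M + l),
          tsum_mul_tsum_of_summable_norm (hconv _) (hconv _), ← tsum_mul_left]
        refine tsum_congr fun x => ?_
        have e : q ^ (2 * (M - (x.1 + x.2))) =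
            q ^ (2 * M) * q ^ (-(2 * x.1)) * q ^ (-(2 * x.2)) := by
          rw [← zpow_add₀ hq0.ne', ← zpow_add₀ hq0.ne']; ring_nf
        simp only [hFdef, eulerConv]
        rw [e, show M - (x.1 + x.2) + x.2 = M - x.1 by ring,
          show M - (x.1 + x.2) + l + x.1 = M + l - x.2 by ring]
        ring
    _ = _ := by
        rw [tsum_eq_single 0 fun M hM => by simp [hM]]
        simp

/-- The convolution square of `eulerConv q N`, up to reversal and shift of the argument. -/
def eulerConvSq (q : ℝ) (N a : ℤ) : ℝ := ∑' k : ℤ, eulerConv q N k * eulerConv q N (N - a - k)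

lemma eulerConvSq_rec {q : ℝ} (hq0 : 0 < q) (hq1 : q < 1) (N a : ℤ) :
    (1 - q ^ (2 * (N + 1))) ^ 2 * eulerConvSq q (N + 1) a = q ^ (2 * (N + 1 - a)) *
      (eulerConvSq q N (a + 1) - 2 * eulerConvSq q N a + eulerConvSq q N (a - 1)) := by
  let g : ℤ → ℤ → ℝ := fun c k => eulerConv q N k * eulerConv q N (c - k)
  have hg : ∀ c, Summable (g c) := fun c => summable_eulerConv_mul q N _
  have hg' : ∀ c, Summable fun k => g c (k - 1) := fun c =>
    (hg c).comp_injective (Equiv.subRight (1 : ℤ)).injective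
  have hsum : ∑' k, (g (N - (a - 1)) k - g (N - a) k - g (N - a) (k - 1) +
      g (N - (a + 1)) (k - 1)) =
      eulerConvSq q N (a + 1) - 2 * eulerConvSq q N a + eulerConvSq q N (a - 1) := by
    rw [(((hg _).sub (hg _)).sub (hg' _)).tsum_add (hg' _),
      ((hg _).sub (hg _)).tsum_sub (hg' _), (hg _).tsum_sub (hg _), tsum_shift (g (N - a)),
      tsum_shift (g (N - (a + 1)))]
    simp only [g, eulerConvSq]
    ring
  rw [← hsum, eulerConvSq, ← tsum_mul_left, ← tsum_mul_left]
  refine tsum_congr fun k => ?_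
  have r1 := eulerConv_rec hq0 hq1 (N + 1) k
  have r2 := eulerConv_rec hq0 hq1 (N + 1) (N + 1 - a - k)
  rw [add_sub_cancel_right] at r1 r2
  have e : q ^ (2 * (N + 1 - a)) = q ^ (2 * k) * q ^ (2 * (N + 1 - a - k)) := by
    rw [← zpow_add₀ hq0.ne']; ring_nf
  simp only [g]
  rw [e, show N - (a - 1) - k = N + 1 - a - k by ring,
    show N - a - k = N + 1 - a - k - 1 by ring, show N - a - (k - 1) = N + 1 - a - k by ring,
    show N - (a + 1) - (k - 1) = N + 1 - a - k - 1 by ring]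
  calc _ = ((1 - q ^ (2 * (N + 1))) * eulerConv q (N + 1) k) *
        ((1 - q ^ (2 * (N + 1))) * eulerConv q (N + 1) (N + 1 - a - k)) := by ring
    _ = _ := by rw [r1, r2]; ring

/-- The moments of the products `J_0(q^n, q²) J_0(q^{n+a}, q²)`. -/
lemma tsum_moment {q : ℝ} (hq0 : 0 < q) (hq1 : q < 1) (j : ℕ) (a : ℤ) :
    invPoch q j * eulerCoeff q j * (∑' n : ℤ, q ^ (2 * n * (j + 1)) *
      (latticeBessel q n * latticeBessel q (n + a))) = eulerConvSq q j a := by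
  induction j generalizing a with
  | zero =>
    have h := tsum_latticeBessel_mul hq0 hq1 a
    simp only [Nat.cast_zero, invPoch_zero, eulerCoeff_zero, zero_add, mul_one, one_mul, h,
      eulerConvSq, eulerConv_zero]
    rw [tsum_eq_single 0 fun k hk => by simp [hk]]
    simp
  | succ j ih =>
    have hs := summable_moment hq0 hq1 j
    have h0 : (1 - q ^ (2 * ((j : ℤ) + 1))) ^ 2 ≠ 0 :=
      pow_ne_zero _ (one_sub_zpow_ne_zero hq0 hq1 (by omega))
    have hm : (∑' n : ℤ, q ^ (2 * n * ((j : ℤ) + 1 + 1)) *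
        (latticeBessel q n * latticeBessel q (n + a))) =
        -q ^ (-(2 * a)) * ((∑' n : ℤ, q ^ (2 * n * ((j : ℤ) + 1)) *
          (latticeBessel q n * latticeBessel q (n + (a + 1)))) -
        2 * (∑' n : ℤ, q ^ (2 * n * ((j : ℤ) + 1)) *
          (latticeBessel q n * latticeBessel q (n + a))) +
        ∑' n : ℤ, q ^ (2 * n * ((j : ℤ) + 1)) *
          (latticeBessel q n * latticeBessel q (n + (a - 1)))) := by
      rw [← tsum_mul_left (a := (2 : ℝ)), ← (hs _).tsum_sub ((hs _).mul_left 2),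
        ← ((hs _).sub ((hs _).mul_left 2)).tsum_add (hs _), ← tsum_mul_left]
      refine tsum_congr fun n => ?_
      have r := latticeBessel_rec hq0 hq1 (n + a)
      have e : q ^ (2 * n * ((j : ℤ) + 1 + 1)) =
          q ^ (-(2 * a)) * q ^ (2 * n * ((j : ℤ) + 1)) * q ^ (2 * (n + a)) := by
        rw [← zpow_add₀ hq0.ne', ← zpow_add₀ hq0.ne']; ring_nf
      rw [e, ← add_assoc, ← add_sub_assoc]
      linear_combination
        q ^ (-(2 * a)) * q ^ (2 * n * ((j : ℤ) + 1)) * latticeBessel q n * r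
    apply mul_left_cancel₀ h0
    have r1 := invPoch_rec hq0 hq1 ((j : ℤ) + 1)
    have r2 := eulerCoeff_rec hq0 hq1 ((j : ℤ) + 1)
    rw [add_sub_cancel_right] at r1 r2
    push_cast
    rw [eulerConvSq_rec hq0 hq1, hm, ← ih (a + 1), ← ih a, ← ih (a - 1)]
    have e : q ^ (2 * ((j : ℤ) + 1 - a)) = q ^ (2 * ((j : ℤ) + 1)) * q ^ (-(2 * a)) := by
      rw [← zpow_add₀ hq0.ne']; ring_nf
    rw [e]
    generalize (∑' n : ℤ, q ^ (2 * n * ((j : ℤ) + 1)) *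
      (latticeBessel q n * latticeBessel q (n + (a + 1)))) = X
    generalize (∑' n : ℤ, q ^ (2 * n * ((j : ℤ) + 1)) *
      (latticeBessel q n * latticeBessel q (n + a))) = Y
    generalize (∑' n : ℤ, q ^ (2 * n * ((j : ℤ) + 1)) *
      (latticeBessel q n * latticeBessel q (n + (a - 1)))) = Z
    calc _ = (invPoch q (j + 1) * (1 - q ^ (2 * ((j : ℤ) + 1)))) *
          (eulerCoeff q (j + 1) * (1 - q ^ (2 * ((j : ℤ) + 1)))) *
          (-q ^ (-(2 * a)) * (X - 2 * Y + Z)) := by ring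
      _ = _ := by rw [r1, r2]; ring

/-- `∫ J_0(t) J_0(q^a t) J_0(q^b t) t d_q t` equals, up to normalization, `J_a(q^b, q²)²`. -/
lemma tsum_triple_product {q : ℝ} (hq0 : 0 < q) (hq1 : q < 1) (a b : ℤ) :
    ∑' n : ℤ, q ^ (2 * n) * (latticeBessel q n * latticeBessel q (n + a)) *
      latticeBessel q (b + n) =
    q ^ (2 * a * b) * (∑' k : ℤ, eulerCoeff q k * invPoch q (a + k) * q ^ (2 * b * k)) ^ 2 := by
  have hs := summable_eulerCoeff_mul_invPoch hq0 hq1 a (2 * b)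
  have hp := summable_mul_of_summable_norm hs hs
  let H : ℤ → ℤ → ℝ := fun k j => q ^ (2 * j * b) *
    (eulerConv q j k * eulerConv q j (j - a - k))
  have hH : ∀ k j, q ^ (2 * a * b) * ((eulerCoeff q k * invPoch q (a + k) * q ^ (2 * b * k)) *
      (eulerCoeff q (j - (a + k)) * invPoch q (a + (j - (a + k))) *
        q ^ (2 * b * (j - (a + k))))) = H k j := fun k j => by
    have e : q ^ (2 * j * b) =
        q ^ (2 * a * b) * q ^ (2 * b * k) * q ^ (2 * b * (j - (a + k))) := by
      rw [← zpow_add₀ hq0.ne', ← zpow_add₀ hq0.ne']; ring_nf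
    simp only [H, eulerConv]
    rw [e, show j - a - k = j - (a + k) by ring, show a + (j - (a + k)) = j - k by ring,
      show j - (j - (a + k)) = a + k by ring]
    ring
  have hHs : Summable (Function.uncurry H) := by
    have h := (hp.mul_left (q ^ (2 * a * b))).comp_injective
      (Equiv.prodShear (Equiv.refl ℤ) fun k => Equiv.subRight (a + k)).injective
    exact h.congr fun x => hH x.1 x.2
  calc _ = ∑' n, ∑' j : ℤ, q ^ (2 * n) * (latticeBessel q n * latticeBessel q (n + a)) *
        (invPoch q j * eulerCoeff q j * q ^ (2 * j * (b + n))) := by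
        refine tsum_congr fun n => ?_
        rw [tsum_mul_left, ← latticeBessel]
    _ = ∑' j : ℤ, ∑' n, q ^ (2 * n) * (latticeBessel q n * latticeBessel q (n + a)) *
        (invPoch q j * eulerCoeff q j * q ^ (2 * j * (b + n))) :=
        (summable_triple_kernel hq0 hq1 a b).tsum_comm.symm
    _ = ∑' j, q ^ (2 * j * b) * eulerConvSq q j a := by
        refine tsum_congr fun j => ?_
        rcases lt_or_ge j 0 with h | h
        · rw [eulerConvSq]
          simp [eulerConv_eq_zero q (show _ ∉ Finset.Icc (0 : ℤ) j by simp [h]),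
            invPoch_of_neg q h]
        · lift j to ℕ using h
          rw [← tsum_moment hq0 hq1, ← tsum_mul_left, ← tsum_mul_left]
          refine tsum_congr fun n => ?_
          have e : q ^ (2 * n) * q ^ (2 * (j : ℤ) * (b + n)) =
              q ^ (2 * (j : ℤ) * b) * q ^ (2 * n * ((j : ℤ) + 1)) := by
            rw [← zpow_add₀ hq0.ne', ← zpow_add₀ hq0.ne']; ring_nf
          linear_combination (latticeBessel q n * latticeBessel q (n + a) *
            (invPoch q j * eulerCoeff q j)) * e
    _ = ∑' j, ∑' k, H k j := by
        simp only [H, eulerConvSq, tsum_mul_left]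
    _ = ∑' k, ∑' j, H k j := hHs.tsum_comm
    _ = _ := by
        rw [sq, ← tsum_mul_right, ← tsum_mul_left]
        refine tsum_congr fun k => ?_
        rw [← tsum_mul_left, ← tsum_mul_left, ← tsum_congr (hH k)]
        exact tsum_shift (fun j => q ^ (2 * a * b) * ((eulerCoeff q k * invPoch q (a + k) *
          q ^ (2 * b * k)) * (eulerCoeff q j * invPoch q (a + j) * q ^ (2 * b * j)))) (a + k)

lemma latticeBessel_eq_jHE (q : ℝ) (n : ℤ) :
    jHE q 0 (q ^ n) = latticeBessel q n := by
  have hsupp : Function.support (fun j : ℤ => invPoch q j * eulerCoeff q j * q ^ (2 * j * n)) ⊆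
      Set.range ((↑) : ℕ → ℤ) := fun j hj => by
    rcases lt_or_ge j 0 with h | h
    · simp [invPoch_of_neg q h] at hj
    · exact ⟨j.toNat, by omega⟩
  rw [latticeBessel, ← Function.Injective.tsum_eq Nat.cast_injective hsupp, jHE]
  refine tsum_congr fun j => ?_
  have e0 : q ^ (2 * 0 + 2 : ℝ) = q ^ 2 := by
    rw [mul_zero, zero_add]
    exact_mod_cast Real.rpow_natCast q 2
  have e1 : (q ^ n) ^ (2 * j) = q ^ (2 * (j : ℤ) * n) := by
    rw [← zpow_natCast, ← zpow_mul]
    push_cast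
    ring_nf
  have e2 : q ^ (j * (j + 1)) = q ^ ((j : ℤ) * (j + 1)) := by
    rw [← zpow_natCast]
    push_cast
    rfl
  rw [e0, e1, e2, eulerCoeff, invPoch_natCast, zpow_natCast]
  ring

lemma qPochInf_zpow {q : ℝ} (hq0 : 0 < q) (hq1 : q < 1) (N : ℤ) :
    qPochInf (q ^ (2 * (N + 1))) (q ^ 2) = qPochInf (q ^ 2) (q ^ 2) * invPoch q N := by
  have e : ∀ i : ℕ, q ^ (2 * (N + 1)) * (q ^ 2) ^ i = q ^ (2 * (N + 1 + i)) := fun i => by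
    rw [mul_add 2 (N + 1), zpow_add₀ hq0.ne', zpow_mul q 2 (i : ℤ)]
    norm_cast
  rcases lt_or_ge N 0 with h | h
  · rw [invPoch_of_neg q h, mul_zero, qPochInf]
    refine tprod_of_exists_eq_zero ⟨(-N - 1).toNat, ?_⟩
    rw [e, show N + 1 + ((-N - 1).toNat : ℤ) = 0 by omega]
    simp
  · lift N to ℕ using h
    have h1 : qPoch (q ^ 2) (q ^ 2) N * qPochInf (q ^ (2 * ((N : ℤ) + 1))) (q ^ 2) =
        qPochInf (q ^ 2) (q ^ 2) := by
      have e' : ∀ i : ℕ, 1 - q ^ (2 * ((N : ℤ) + 1)) * (q ^ 2) ^ i =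
          1 - q ^ 2 * (q ^ 2) ^ (i + N) := fun i => by
        rw [e, ← pow_succ', ← pow_mul, ← zpow_natCast]
        push_cast
        ring_nf
      have hm := multipliable_qPochInf hq0 hq1 (q ^ (2 * ((N : ℤ) + 1)))
      simp only [e'] at hm
      rw [qPochInf, tprod_congr e', qPoch]
      exact Multipliable.prod_mul_tprod_nat_mul' (f := fun i => 1 - q ^ 2 * (q ^ 2) ^ i) hm
    have h2 : qPoch (q ^ 2) (q ^ 2) N ≠ 0 := fun h0 => by
      rw [h0, zero_mul] at h1
      exact qPochInf_sq_ne_zero hq0 hq1 h1.symm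
    rw [invPoch_natCast, ← h1]
    field_simp

lemma JHE_eq_tsum {q : ℝ} (hq0 : 0 < q) (hq1 : q < 1) (a b : ℤ) :
    JHE (q ^ 2) (a : ℝ) (q ^ b) =
      q ^ (a * b) * ∑' k : ℤ, eulerCoeff q k * invPoch q (a + k) * q ^ (2 * b * k) := by
  have hsupp : Function.support
      (fun k : ℤ => eulerCoeff q k * invPoch q (a + k) * q ^ (2 * b * k)) ⊆
      Set.range ((↑) : ℕ → ℤ) := fun j hj => by
    rcases lt_or_ge j 0 with h | h
    · simp [eulerCoeff_of_neg q h] at hj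
    · exact ⟨j.toNat, by omega⟩
  have hne := qPochInf_sq_ne_zero hq0 hq1
  rw [← Function.Injective.tsum_eq Nat.cast_injective hsupp, JHE, Real.rpow_intCast, ← zpow_mul,
    div_mul_eq_mul_div, mul_div_assoc, ← tsum_div_const, mul_comm b a]
  congr 1
  refine tsum_congr fun n => ?_
  have e1 : (q ^ 2) ^ ((n : ℝ) * (n + 1) / 2) = q ^ ((n : ℤ) * (n + 1)) := by
    rw [← Real.rpow_natCast, ← Real.rpow_mul hq0.le, ← Real.rpow_intCast]
    push_cast
    ring_nf
  have e2 : (q ^ 2) ^ ((a : ℝ) + n + 1) = q ^ (2 * (a + (n : ℤ) + 1)) := by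
    rw [← Real.rpow_natCast, ← Real.rpow_mul hq0.le, ← Real.rpow_intCast]
    push_cast
    ring_nf
  have e3 : (q ^ b) ^ (2 * n) = q ^ (2 * b * (n : ℤ)) := by
    rw [← zpow_natCast, ← zpow_mul]
    push_cast
    ring_nf
  rw [e1, e2, e3, qPochInf_zpow hq0 hq1, eulerCoeff, invPoch_natCast, zpow_natCast]
  field_simp

/-- explicit formula for the kernel `D_0`. -/
theorem stmt9 (q : ℝ) (hq0 : 0 < q) (hq1 : q < 1) (m z k : ℤ) :
    Dker q 0 (q ^ (m : ℤ)) (q ^ (z : ℤ)) (q ^ (k : ℤ)) =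
      (1 / (1 - q)) * q ^ (-(2 * k) : ℤ) *
        (JHE (q ^ 2) ((z : ℝ) - (k : ℝ)) (q ^ ((m : ℝ) - (k : ℝ)))) ^ 2 := by
  have hq : 1 - q ≠ 0 := (sub_pos.2 hq1).ne'
  have hc : cqv q 0 = 1 / (1 - q) := by
    have e : q ^ (2 * 0 + 2 : ℝ) = q ^ 2 := by
      rw [mul_zero, zero_add]
      exact_mod_cast Real.rpow_natCast q 2
    rw [cqv, e, mul_div_assoc, div_self (qPochInf_sq_ne_zero hq0 hq1), mul_one]
  have hx : q ^ ((m : ℝ) - (k : ℝ)) = q ^ (m - k) := by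
    rw [← Real.rpow_intCast]
    push_cast
    rfl
  have hsum : (∑' n : ℤ, q ^ n * (jHE q 0 (q ^ m * q ^ n) * jHE q 0 (q ^ z * q ^ n) *
      jHE q 0 (q ^ k * q ^ n) * (q ^ n) ^ (2 * 0 + 1 : ℝ))) =
      q ^ (-(2 * k)) * ∑' n : ℤ, q ^ (2 * n) *
        (latticeBessel q n * latticeBessel q (n + (z - k))) * latticeBessel q (m - k + n) := by
    rw [← tsum_shift _ k, ← tsum_mul_left]
    refine tsum_congr fun n => ?_
    have e : q ^ (n - k) * q ^ (n - k) = q ^ (-(2 * k)) * q ^ (2 * n) := by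
      rw [← zpow_add₀ hq0.ne', ← zpow_add₀ hq0.ne']; ring_nf
    simp only [← zpow_add₀ hq0.ne', latticeBessel_eq_jHE q, mul_zero, zero_add, Real.rpow_one]
    rw [show m + (n - k) = m - k + n by ring, show z + (n - k) = n + (z - k) by ring,
      show k + (n - k) = n by ring]
    linear_combination (latticeBessel q (m - k + n) * latticeBessel q (n + (z - k)) *
      latticeBessel q n) * e
  rw [Dker, jackson, hsum, tsum_triple_product hq0 hq1, hc, hx, ← Int.cast_sub,
    JHE_eq_tsum hq0 hq1, mul_pow _ (tsum _), ← zpow_natCast (q ^ _) 2, ← zpow_mul,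
    show (z - k) * (m - k) * ((2 : ℕ) : ℤ) = 2 * (z - k) * (m - k) by push_cast; ring]
  field_simp
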